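/- arXiv:1709.04440 — 2 statements merged into one kernel-verified Lean document; each statement's English description precedes it below -/
import Mathlib

section
/- Let p be a prime and k ≥ 4 an integer, and assume the disjoint-cycles bound holds for every integer k' with 3 ≤ k' < k. Let n be a positive integer, let X_1,…,X_k ⊆ F_p^n, let δ' > 0 be such that the number of k-cycles in X_1×⋯×X_k equals δ' N^{k−1}, let θ ≥ 1 be such that for every i ∈ {1,…,k} each point of X_i occurs as the i-th coordinate of at most θ δ' N^{k−2} k-cycles, and set α = (θδ')^{1/(k−2)}. Let M be a collection of k-cycles in X_1×⋯×X_k with |M| ≥ r δ' N^{k−1} for a real number 0 < r < 1, and let I_1, I_2 ⊆ {1,…,k} be disjoint subsets with I_1 ∪ I_2 = {1,…,k}, 2 ≤ |I_1| ≤ k−2 and 2 ≤ |I_2| ≤ k−2. Assume: (i) every I_1-tuple (x_i)_{i∈I_1} ∈ ∏_{i∈I_1} X_i can be extended in at most 2 α^{k−|I_1|−1} N^{k−|I_1|−1} different ways to a k-cycle (x_1,…,x_k) ∈ M; and (ii) for every (x_1,…,x_k) ∈ M, the I_2-tuple (x_i)_{i∈I_2} is not a bad I_2-tuple. Then δ'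 θ^{C_{p,k}} ≥ (r/(4k))^{C_{p,k}}. -/
open scoped Classical

/-- The set of k-cycles in X 0 x ... x X (k-1): tuples with i-th coordinate in X i
summing to zero. -/
noncomputable def cycleSet {V : Type} [AddCommGroup V] [Fintype V] (k : ℕ)
    (X : Fin k → Finset V) : Finset (Fin k → V) :=
  (Fintype.piFinset X).filter fun x => ∑ i, x i = 0

/-- An I-tuple (represented by a full tuple x, of which only the coordinates in I matter)
is bad if it can be extended in at least 2 * α^(k-|I|-1) * N^(k-|I|-1) different ways to a
k-cycle in X 0 x ... x X (k-1). -/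
noncomputable def IsBad {V : Type} [AddCommGroup V] [Fintype V] (k : ℕ)
    (X : Fin k → Finset V) (α N : ℝ) (I : Finset (Fin k)) (x : Fin k → V) : Prop :=
  2 * α ^ (k - I.card - 1) * N ^ (k - I.card - 1) ≤
    (((cycleSet k X).filter fun y => ∀ i ∈ I, y i = x i).card : ℝ)

/-- The constant c_{p,3} ∈ (0,1), defined by
inf_{0<t<1} (t^0 + ... + t^(p-1)) / t^((p-1)/3) = p^(1 - c_{p,3}). -/
noncomputable def cp3 (p : ℕ) : ℝ :=
  1 - Real.logb p (sInf ((fun t : ℝ =>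
    (∑ j ∈ Finset.range p, t ^ j) / t ^ (((p : ℝ) - 1) / 3)) '' Set.Ioo 0 1))

/-- The constant C_{p,k} = (k-2)/c_{p,3} + 1. -/
noncomputable def Cconst (p k : ℕ) : ℝ := ((k : ℝ) - 2) / cp3 p + 1

/-- If every element of `M` is `R`-related to at most `B` elements of `M`, then `M` contains a
subset of pairwise unrelated elements of size at least `M.card / B`. -/
theorem exists_pairwise_not_rel_card_le {ι : Type*} (M : Finset ι) (R : ι → ι → Prop)
    [∀ a, DecidablePred (R a)] (hrefl : ∀ a, R a a) (hsymm : ∀ a b, R a b → R b a) (B : ℝ)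
    (hB : ∀ d ∈ M, ((M.filter (R d)).card : ℝ) ≤ B) :
    ∃ D ⊆ M, (∀ a ∈ D, ∀ b ∈ D, a ≠ b → ¬ R a b) ∧ (M.card : ℝ) ≤ D.card * B := by
  obtain ⟨D, hD⟩ := Finset.exists_maximal
    (s := M.powerset.filter fun D => ∀ a ∈ D, ∀ b ∈ D, a ≠ b → ¬ R a b) ⟨∅, by simp⟩
  have hmem := hD.prop
  simp only [Finset.mem_filter, Finset.mem_powerset] at hmem
  refine ⟨D, hmem.1, hmem.2, ?_⟩
  have hcover : M ⊆ D.biUnion fun d => M.filter (R d) := by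
    intro m hm
    simp only [Finset.mem_biUnion, Finset.mem_filter]
    by_contra! hcon
    have hmD : m ∉ D := fun h => hcon m h hm (hrefl m)
    have hins : insert m D ∈
        M.powerset.filter fun D => ∀ a ∈ D, ∀ b ∈ D, a ≠ b → ¬ R a b := by
      simp only [Finset.mem_filter, Finset.mem_powerset]
      refine ⟨Finset.insert_subset hm hmem.1, ?_⟩
      intro a ha b hb hab hR
      rcases Finset.mem_insert.1 ha with rfl | haD <;> rcases Finset.mem_insert.1 hb with rfl | hbD
      · exact hab rfl
      · exact hcon b hbD hm (hsymm _ _ hR)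
      · exact hcon a haD hm hR
      · exact hmem.2 a haD b hbD hab hR
    exact hmD (hD.le_of_ge hins (Finset.subset_insert m D) (Finset.mem_insert_self m D))
  calc (M.card : ℝ) ≤ ((D.biUnion fun d => M.filter (R d)).card : ℝ) := by
        exact_mod_cast Finset.card_le_card hcover
    _ ≤ ∑ d ∈ D, ((M.filter (R d)).card : ℝ) := by exact_mod_cast Finset.card_biUnion_le
    _ ≤ ∑ d ∈ D, B := Finset.sum_le_sum fun d hd => hB d (hmem.1 hd)
    _ = D.card * B := by simp

theorem card_le_card_mul_of_card_fiber_le {ι κ : Type*} [DecidableEq κ] {s : Finset ι}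
    {t : Finset κ} {f : ι → κ} (hf : ∀ x ∈ s, f x ∈ t) {B : ℝ}
    (hB : ∀ y ∈ t, ((s.filter fun x => f x = y).card : ℝ) ≤ B) :
    (s.card : ℝ) ≤ t.card * B := by
  rw [Finset.card_eq_sum_card_fiberwise hf, Nat.cast_sum]
  exact (Finset.sum_le_sum hB).trans (by simp)

section Cycles

variable {V : Type} [AddCommGroup V] {k : ℕ} {X : Fin k → Finset V}

theorem mem_cycleSet [Fintype V] {x : Fin k → V} :
    x ∈ cycleSet k X ↔ (∀ i, x i ∈ X i) ∧ ∑ i, x i = 0 := by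
  simp [cycleSet]

variable {I₁ I₂ : Finset (Fin k)}

theorem sum_add_sum_eq_sum_univ (hd : Disjoint I₁ I₂) (hu : I₁ ∪ I₂ = Finset.univ)
    (x : Fin k → V) : ∑ i ∈ I₁, x i + ∑ i ∈ I₂, x i = ∑ i, x i := by
  rw [← Finset.sum_union hd, hu]

/-- The cycles of `M` whose `I₁`-sum is prescribed by `d` are controlled by the number of
extensions of the `I₂`-part of `d`. -/
theorem card_filter_sum_eq_le [Fintype V] [DecidableEq V] (hd : Disjoint I₁ I₂)
    (hu : I₁ ∪ I₂ = Finset.univ) {M : Finset (Fin k → V)} (hM : M ⊆ cycleSet k X) {B : ℝ}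
    (hB : ∀ x : Fin k → V, (∀ i ∈ I₁, x i ∈ X i) →
      ((M.filter fun y => ∀ i ∈ I₁, y i = x i).card : ℝ) ≤ B)
    {d : Fin k → V} (hdX : d ∈ cycleSet k X) :
    ((M.filter fun m => ∑ i ∈ I₂, d i = ∑ i ∈ I₂, m i).card : ℝ) ≤
      ((cycleSet k X).filter fun y => ∀ i ∈ I₂, y i = d i).card * B := by
  have hI₂ : ∀ i ∈ I₂, i ∉ I₁ := fun i h₂ h₁ => Finset.disjoint_left.1 hd h₁ h₂
  refine card_le_card_mul_of_card_fiber_le (f := fun m i => if i ∈ I₁ then m i else d i) ?_ ?_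
  · intro m hm
    obtain ⟨hmM, hs⟩ := Finset.mem_filter.1 hm
    obtain ⟨hmX, hm0⟩ := mem_cycleSet.1 (hM hmM)
    refine Finset.mem_filter.2 ⟨mem_cycleSet.2 ⟨fun i => ?_, ?_⟩, fun i hi => ?_⟩
    · split_ifs
      · exact hmX i
      · exact (mem_cycleSet.1 hdX).1 i
    · rw [← sum_add_sum_eq_sum_univ hd hu] at hm0 ⊢
      rw [← hm0, ← hs]
      congr 1
      · exact Finset.sum_congr rfl fun i hi => by simp [hi]
      · exact Finset.sum_congr rfl fun i hi => by simp [hI₂ i hi]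
    · simp [hI₂ i hi]
  · intro y hy
    refine le_trans ?_ (hB y fun i _ => (mem_cycleSet.1 (Finset.mem_filter.1 hy).1).1 i)
    refine Nat.cast_le.2 (Finset.card_le_card fun m hm => ?_)
    simp only [Finset.mem_filter] at hm ⊢
    refine ⟨hm.1.1, fun i hi => ?_⟩
    have := congrFun hm.2 i
    simpa [hi] using this

/-- The sets `X i` for `i ∈ I₁`, preceded by the set of `I₂`-sums of `D`. -/
noncomputable def contractedSets [DecidableEq V] {m : ℕ} (X : Fin k → Finset V)
    (I₂ : Finset (Fin k)) (e : Fin m ≃ I₁) (D : Finset (Fin k → V)) : Fin (m + 1) → Finset V :=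
  Fin.cons (D.image fun d => ∑ i ∈ I₂, d i) fun j => X (e j)

/-- The cycle obtained from `d` by merging the coordinates in `I₂` into their sum. -/
def contractedCycle {m : ℕ} (I₂ : Finset (Fin k)) (e : Fin m ≃ I₁) (d : Fin k → V) :
    Fin (m + 1) → V :=
  Fin.cons (∑ i ∈ I₂, d i) fun j => d (e j)

theorem sum_comp_equiv {m : ℕ} (e : Fin m ≃ I₁) (x : Fin k → V) :
    ∑ j, x (e j) = ∑ i ∈ I₁, x i := by
  rw [Equiv.sum_comp e fun i : I₁ => x i, Finset.sum_coe_sort]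

theorem contractedCycle_mem [Fintype V] [DecidableEq V] {m : ℕ} (hd : Disjoint I₁ I₂)
    (hu : I₁ ∪ I₂ = Finset.univ) (e : Fin m ≃ I₁) {D : Finset (Fin k → V)}
    (hD : D ⊆ cycleSet k X) {d : Fin k → V} (hdD : d ∈ D) :
    contractedCycle I₂ e d ∈ cycleSet (m + 1) (contractedSets X I₂ e D) := by
  obtain ⟨hX, h0⟩ := mem_cycleSet.1 (hD hdD)
  refine mem_cycleSet.2 ⟨fun j => ?_, ?_⟩
  · induction j using Fin.cases with
    | zero => exact Finset.mem_image_of_mem (fun d => ∑ i ∈ I₂, d i) hdD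
    | succ j => exact hX (e j)
  · rw [Fin.sum_univ_succ]
    simp only [contractedCycle, Fin.cons_zero, Fin.cons_succ]
    rw [sum_comp_equiv e d, add_comm, sum_add_sum_eq_sum_univ hd hu, h0]

theorem card_cycleSet_contractedSets_le [Fintype V] [DecidableEq V] {m : ℕ}
    (hd : Disjoint I₁ I₂) (hu : I₁ ∪ I₂ = Finset.univ) (e : Fin m ≃ I₁) {D : Finset (Fin k → V)}
    (hD : D ⊆ cycleSet k X) {B : ℝ} (hB0 : 0 ≤ B)
    (hB : ∀ d ∈ D, (((cycleSet k X).filter fun y => ∀ i ∈ I₂, y i = d i).card : ℝ) ≤ B) :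
    ((cycleSet (m + 1) (contractedSets X I₂ e D)).card : ℝ) ≤ D.card * B := by
  have hI₂ : ∀ i ∈ I₂, i ∉ I₁ := fun i h₂ h₁ => Finset.disjoint_left.1 hd h₁ h₂
  have hfiber : ((cycleSet (m + 1) (contractedSets X I₂ e D)).card : ℝ) ≤
      (D.image fun d => ∑ i ∈ I₂, d i).card * B := by
    refine card_le_card_mul_of_card_fiber_le (f := fun y => y 0)
      (fun y hy => (mem_cycleSet.1 hy).1 0) fun s hs => ?_
    obtain ⟨d, hdD, rfl⟩ := Finset.mem_image.1 hs
    refine le_trans (Nat.cast_le.2 ?_) (hB d hdD)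
    refine Finset.card_le_card_of_injOn
      (fun y i => if h : i ∈ I₁ then y (Fin.succ (e.symm ⟨i, h⟩)) else d i) ?_ ?_
    · intro y hy
      obtain ⟨hy, hys⟩ := Finset.mem_filter.1 (Finset.mem_coe.1 hy)
      obtain ⟨hyX, hy0⟩ := mem_cycleSet.1 hy
      refine Finset.mem_coe.2 (Finset.mem_filter.2
        ⟨mem_cycleSet.2 ⟨fun i => ?_, ?_⟩, fun i hi => ?_⟩)
      · dsimp only
        split_ifs with h
        · simpa [contractedSets] using hyX (Fin.succ (e.symm ⟨i, h⟩))
        · exact (mem_cycleSet.1 (hD hdD)).1 i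
      · rw [← sum_add_sum_eq_sum_univ hd hu, ← sum_comp_equiv e,
          ← hy0, Fin.sum_univ_succ, hys, add_comm]
        congr 1
        · exact Finset.sum_congr rfl fun i hi => by simp [hI₂ i hi]
        · exact Finset.sum_congr rfl fun j _ => by simp
      · simp [hI₂ i hi]
    · intro y hy z hz hyz
      have hy' := (Finset.mem_filter.1 (Finset.mem_coe.1 hy)).2
      have hz' := (Finset.mem_filter.1 (Finset.mem_coe.1 hz)).2
      refine funext (Fin.cases (hy'.trans hz'.symm) fun j => ?_)
      have := congrFun hyz (e j)
      simpa using this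
  exact hfiber.trans (mul_le_mul_of_nonneg_right (by exact_mod_cast Finset.card_image_le) hB0)

end Cycles

theorem exists_sum_pow_lt_mul_rpow {p : ℕ} (hp : 2 ≤ p) :
    ∃ t ∈ Set.Ioo (0 : ℝ) 1,
      ∑ j ∈ Finset.range p, t ^ j < p * t ^ (((p : ℝ) - 1) / 3) := by
  have hp' : (2 : ℝ) ≤ p := by exact_mod_cast hp
  set g : ℝ → ℝ := fun t => ∑ j ∈ Finset.range p, t ^ j - p * t ^ (((p : ℝ) - 1) / 3) with hg
  have hder : HasDerivAt g (∑ j ∈ Finset.range p, (j : ℝ) - p * (((p : ℝ) - 1) / 3)) 1 := by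
    have h₁ : HasDerivAt (fun t : ℝ => ∑ j ∈ Finset.range p, t ^ j)
        (∑ j ∈ Finset.range p, (j : ℝ)) 1 := by
      refine HasDerivAt.fun_sum fun j _ => ?_
      simpa using hasDerivAt_pow j (1 : ℝ)
    have h₂ := (Real.hasDerivAt_rpow_const (x := 1) (p := ((p : ℝ) - 1) / 3)
      (Or.inl one_ne_zero)).const_mul (p : ℝ)
    simp only [Real.one_rpow, mul_one] at h₂
    exact h₁.sub h₂
  have hsum : ∑ j ∈ Finset.range p, (j : ℝ) = p * ((p : ℝ) - 1) / 2 := by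
    have := Finset.sum_range_id_mul_two p
    have h : ((∑ j ∈ Finset.range p, j : ℕ) : ℝ) * 2 = p * ((p - 1 : ℕ) : ℝ) := by
      exact_mod_cast this
    rw [Nat.cast_sum, Nat.cast_sub (by omega), Nat.cast_one] at h
    linarith
  have hpos : 0 < ∑ j ∈ Finset.range p, (j : ℝ) - p * (((p : ℝ) - 1) / 3) := by
    rw [hsum]
    nlinarith
  have hg1 : g 1 = 0 := by simp [hg]
  have hslope := (hasDerivAt_iff_tendsto_slope.1 hder).eventually (lt_mem_nhds hpos)
  have hleft : ∀ᶠ t in nhdsWithin (1 : ℝ) (Set.Iio 1), 0 < slope g 1 t :=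
    hslope.filter_mono (nhdsWithin_mono _ fun t (ht : t < 1) => ht.ne)
  obtain ⟨t, ht, ht'⟩ := (hleft.and (Ioo_mem_nhdsLT (zero_lt_one' ℝ))).exists
  refine ⟨t, ht', ?_⟩
  rw [slope_def_field, hg1, sub_zero] at ht
  have : g t < 0 := by
    by_contra! hcon
    exact absurd ht (not_lt.2 (div_nonpos_of_nonneg_of_nonpos hcon (by linarith [ht'.2])))
  simp only [hg] at this
  linarith

theorem one_le_sum_pow_div_rpow {p : ℕ} (hp : 2 ≤ p) {t : ℝ} (ht : t ∈ Set.Ioo (0 : ℝ) 1) :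
    1 ≤ (∑ j ∈ Finset.range p, t ^ j) / t ^ (((p : ℝ) - 1) / 3) := by
  have hp' : (2 : ℝ) ≤ p := by exact_mod_cast hp
  rw [one_le_div (Real.rpow_pos_of_pos ht.1 _)]
  calc t ^ (((p : ℝ) - 1) / 3) ≤ 1 := Real.rpow_le_one ht.1.le ht.2.le (by linarith)
    _ = t ^ 0 := (pow_zero t).symm
    _ ≤ ∑ j ∈ Finset.range p, t ^ j :=
      Finset.single_le_sum (f := fun j => t ^ j) (fun j _ => pow_nonneg ht.1.le j)
        (Finset.mem_range.2 (by omega))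

theorem cp3_pos_and_le_one {p : ℕ} (hp : 2 ≤ p) : 0 < cp3 p ∧ cp3 p ≤ 1 := by
  have hp' : (1 : ℝ) < p := by exact_mod_cast (by omega : 1 < p)
  set S : Set ℝ := (fun t : ℝ =>
    (∑ j ∈ Finset.range p, t ^ j) / t ^ (((p : ℝ) - 1) / 3)) '' Set.Ioo 0 1 with hS
  have hlow : ∀ y ∈ S, 1 ≤ y := by
    rintro _ ⟨t, ht, rfl⟩
    exact one_le_sum_pow_div_rpow hp ht
  obtain ⟨t, ht, hlt⟩ := exists_sum_pow_lt_mul_rpow hp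
  have hne : S.Nonempty := ⟨_, Set.mem_image_of_mem _ ht⟩
  have h1 : 1 ≤ sInf S := le_csInf hne hlow
  have h2 : sInf S < p :=
    (csInf_le ⟨1, hlow⟩ (Set.mem_image_of_mem _ ht)).trans_lt
      ((div_lt_iff₀ (Real.rpow_pos_of_pos ht.1 _)).2 hlt)
  have h3 : Real.logb p (sInf S) < 1 := by
    rw [Real.logb_lt_iff_lt_rpow hp' (by linarith), Real.rpow_one]
    exact h2
  have h4 : 0 ≤ Real.logb p (sInf S) := Real.logb_nonneg hp' h1
  unfold cp3
  constructor <;> linarith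

theorem rpow_le_mul_rpow_of_rpow_le {c ε α θ δ u N : ℝ} {m k : ℕ} (hc0 : 0 < c) (hc1 : c ≤ 1)
    (hm : 2 ≤ m) (hk : 2 < k) (hN : 0 < N) (hθ : 0 < θ) (hα : 0 < α)
    (hαk : α ^ (k - 2) = θ * δ) (hu0 : 0 < u) (hu1 : u ≤ 1) (hε : 2 * u / θ ≤ ε)
    (h : ε ^ ((((m + 1 : ℕ) : ℝ) - 2) / c + 1) * N ^ m ≤
      ε * N * (2 * α ^ (m - 1) * N ^ (m - 1))) :
    u ^ (((k : ℝ) - 2) / c + 1) ≤ δ * θ ^ (((k : ℝ) - 2) / c + 1) := by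
  have huθ : 0 < u / θ := div_pos hu0 hθ
  have hε0 : 0 < ε := lt_of_lt_of_le (by positivity) hε
  obtain ⟨q, rfl⟩ : ∃ q, m = q + 1 := ⟨m - 1, by omega⟩
  obtain ⟨l, rfl⟩ : ∃ l, k = l + 2 := ⟨k - 2, by omega⟩
  have hq : q ≠ 0 := by omega
  have hexp : (((q + 1 + 1 : ℕ) : ℝ) - 2) / c = 1 / c * q := by
    push_cast
    ring
  have hexp' : (((l + 2 : ℕ) : ℝ) - 2) / c = 1 / c * l := by
    push_cast
    ring
  rw [hexp, Real.rpow_add_one hε0.ne', Real.rpow_mul_natCast hε0.le] at h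
  simp only [Nat.add_sub_cancel] at h hαk
  have h₁ : (ε ^ (1 / c)) ^ q ≤ 2 * α ^ q := by
    refine le_of_mul_le_mul_right ?_ (show 0 < ε * N ^ (q + 1) by positivity)
    calc (ε ^ (1 / c)) ^ q * (ε * N ^ (q + 1)) = (ε ^ (1 / c)) ^ q * ε * N ^ (q + 1) := by ring
      _ ≤ _ := h
      _ = 2 * α ^ q * (ε * N ^ (q + 1)) := by ring
  have h₂ : ε ^ (1 / c) ≤ 2 * α := by
    refine le_of_pow_le_pow_left₀ hq (by positivity) (h₁.trans ?_)
    rw [mul_pow]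
    gcongr
    exact le_self_pow₀ one_le_two hq
  have h₃ : (u / θ) ^ (1 / c) ≤ α := by
    have h2c : (2 : ℝ) ≤ 2 ^ (1 / c) := by
      calc (2 : ℝ) = 2 ^ (1 : ℝ) := (Real.rpow_one 2).symm
        _ ≤ 2 ^ (1 / c) :=
          Real.rpow_le_rpow_of_exponent_le one_le_two ((one_le_div hc0).2 hc1)
    have hpos : 0 < (u / θ) ^ (1 / c) := Real.rpow_pos_of_pos huθ _
    have h₄ : 2 * (u / θ) ^ (1 / c) ≤ ε ^ (1 / c) := by
      calc 2 * (u / θ) ^ (1 / c) ≤ 2 ^ (1 / c) * (u / θ) ^ (1 / c) := by gcongr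
        _ = (2 * u / θ) ^ (1 / c) := by
          rw [← Real.mul_rpow two_pos.le huθ.le, mul_div_assoc]
        _ ≤ ε ^ (1 / c) := Real.rpow_le_rpow (by positivity) hε (by positivity)
    linarith
  have h₅ : (u / θ) ^ (1 / c * l) ≤ θ * δ := by
    rw [← hαk, Real.rpow_mul_natCast huθ.le]
    exact pow_le_pow_left₀ (by positivity) h₃ l
  rw [Real.div_rpow hu0.le hθ.le, div_le_iff₀ (by positivity)] at h₅
  rw [hexp', Real.rpow_add_one hu0.ne', Real.rpow_add_one hθ.ne']
  calc u ^ (1 / c * l) * u ≤ u ^ (1 / c * l) := mul_le_of_le_one_right (by positivity) hu1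
    _ ≤ θ * δ * θ ^ (1 / c * l) := h₅
    _ = δ * (θ ^ (1 / c * l) * θ) := by ring

theorem key_lemma (p : ℕ) [hp : Fact p.Prime] (k : ℕ) (hk : 4 ≤ k)
    (H : ∀ k' : ℕ, 3 ≤ k' → k' < k → ∀ ε : ℝ, 0 < ε → ε < 1 →
      ∀ n' : ℕ, 0 < n' → ∀ X' : Fin k' → Finset (Fin n' → ZMod p),
      (∃ D : Finset (Fin k' → (Fin n' → ZMod p)), D ⊆ cycleSet k' X' ∧
        (∀ c ∈ D, ∀ c' ∈ D, c ≠ c' → ∀ i, c i ≠ c' i) ∧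
        ε * (p : ℝ) ^ n' ≤ (D.card : ℝ)) →
      ε ^ Cconst p k' * ((p : ℝ) ^ n') ^ (k' - 1) ≤ ((cycleSet k' X').card : ℝ))
    (n : ℕ) (hn : 0 < n) (X : Fin k → Finset (Fin n → ZMod p))
    (δ' θ : ℝ) (hδ' : 0 < δ')
    (hnum : ((cycleSet k X).card : ℝ) = δ' * ((p : ℝ) ^ n) ^ (k - 1))
    (hθ : 1 ≤ θ)
    (hdeg : ∀ i : Fin k, ∀ a ∈ X i,
      (((cycleSet k X).filter fun x => x i = a).card : ℝ) ≤ θ * δ' * ((p : ℝ) ^ n) ^ (k - 2))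
    (α : ℝ) (hα : α = (θ * δ') ^ (1 / ((k : ℝ) - 2)))
    (r : ℝ) (hr0 : 0 < r) (hr1 : r < 1)
    (M : Finset (Fin k → (Fin n → ZMod p))) (hM : M ⊆ cycleSet k X)
    (hMcard : r * δ' * ((p : ℝ) ^ n) ^ (k - 1) ≤ (M.card : ℝ))
    (I₁ I₂ : Finset (Fin k)) (hI₁₂ : Disjoint I₁ I₂) (hIu : I₁ ∪ I₂ = Finset.univ)
    (hI₁a : 2 ≤ I₁.card) (hI₁b : I₁.card ≤ k - 2)
    (hI₂a : 2 ≤ I₂.card) (hI₂b : I₂.card ≤ k - 2)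
    (hi : ∀ x : Fin k → (Fin n → ZMod p), (∀ i ∈ I₁, x i ∈ X i) →
      ((M.filter fun y => ∀ i ∈ I₁, y i = x i).card : ℝ) ≤
        2 * α ^ (k - I₁.card - 1) * ((p : ℝ) ^ n) ^ (k - I₁.card - 1))
    (hii : ∀ x ∈ M, ¬ IsBad k X α ((p : ℝ) ^ n) I₂ x) :
    (r / (4 * (k : ℝ))) ^ Cconst p k ≤ δ' * θ ^ Cconst p k := by
  have hp2 : 2 ≤ p := hp.out.two_le
  obtain ⟨hc0, hc1⟩ := cp3_pos_and_le_one hp2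
  set N : ℝ := (p : ℝ) ^ n with hNdef
  have hN2 : 2 ≤ N := by
    calc (2 : ℝ) ≤ p := by exact_mod_cast hp2
      _ ≤ N := le_self_pow₀ (by exact_mod_cast one_le_two.trans hp2) hn.ne'
  have hN0 : 0 < N := by linarith
  have hk4 : (4 : ℝ) ≤ k := by exact_mod_cast hk
  have hθ0 : 0 < θ := by linarith
  have hα0 : 0 < α := hα ▸ Real.rpow_pos_of_pos (by positivity) _
  have hαk : α ^ (k - 2) = θ * δ' := by
    rw [hα, ← Real.rpow_natCast, ← Real.rpow_mul (by positivity), Nat.cast_sub (by omega),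
      Nat.cast_ofNat, one_div_mul_cancel (by linarith), Real.rpow_one]
  have hcard : I₁.card + I₂.card = k := by
    rw [← Finset.card_union_of_disjoint hI₁₂, hIu, Finset.card_fin]
  set m := I₁.card with hm
  have hext : ∀ d ∈ M, (((cycleSet k X).filter fun y => ∀ i ∈ I₂, y i = d i).card : ℝ) ≤
      2 * α ^ (m - 1) * N ^ (m - 1) := by
    intro d hd
    have := not_le.1 (hii d hd)
    rw [show k - I₂.card - 1 = m - 1 by omega] at this
    refine le_trans (le_of_eq ?_) this.le
    congr!
  set e : Fin m ≃ I₁ := I₁.equivFin.symm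
  set W : ℝ := θ * δ' * N ^ (k - 2) with hW
  have hW0 : 0 < W := by positivity
  have hcoord : ∀ d ∈ M, ∀ i, ((M.filter fun x => d i = x i).card : ℝ) ≤ W := by
    intro d hd i
    refine le_trans (Nat.cast_le.2 (Finset.card_le_card fun x hx => ?_))
      (hdeg i (d i) ((mem_cycleSet.1 (hM hd)).1 i))
    simp only [Finset.mem_filter] at hx ⊢
    exact ⟨hM hx.1, hx.2.symm⟩
  have hsum : ∀ d ∈ M,
      ((M.filter fun x => ∑ i ∈ I₂, d i = ∑ i ∈ I₂, x i).card : ℝ) ≤ 4 * W := by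
    intro d hd
    have h := card_filter_sum_eq_le hI₁₂ hIu hM
      (B := 2 * α ^ (k - m - 1) * N ^ (k - m - 1)) hi (hM hd)
    calc ((M.filter fun x => ∑ i ∈ I₂, d i = ∑ i ∈ I₂, x i).card : ℝ)
        ≤ (2 * α ^ (m - 1) * N ^ (m - 1)) * (2 * α ^ (k - m - 1) * N ^ (k - m - 1)) :=
          h.trans (mul_le_mul_of_nonneg_right (hext d hd) (by positivity))
      _ = 4 * (α ^ ((m - 1) + (k - m - 1)) * N ^ ((m - 1) + (k - m - 1))) := by
          rw [pow_add, pow_add]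
          ring
      _ = 4 * W := by rw [show (m - 1) + (k - m - 1) = k - 2 by omega, hαk, hW]
  obtain ⟨D₀, hD₀M, hD₀, hMD₀⟩ := exists_pairwise_not_rel_card_le M
    (fun x y => ∃ j, contractedCycle I₂ e x j = contractedCycle I₂ e y j)
    (fun x => ⟨0, rfl⟩) (fun x y ⟨j, hj⟩ => ⟨j, hj.symm⟩) ((m + 4) * W) (by
      intro d hd
      have hsub : (M.filter fun x =>
            ∃ j, contractedCycle I₂ e d j = contractedCycle I₂ e x j) ⊆
          (M.filter fun x => ∑ i ∈ I₂, d i = ∑ i ∈ I₂, x i) ∪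
            Finset.univ.biUnion fun j : Fin m => M.filter fun x => d (e j) = x (e j) := by
        intro x hx
        obtain ⟨hxM, j, hj⟩ := Finset.mem_filter.1 hx
        refine Finset.mem_union.2 ?_
        induction j using Fin.cases with
        | zero => exact Or.inl (Finset.mem_filter.2 ⟨hxM, hj⟩)
        | succ j =>
          exact Or.inr (Finset.mem_biUnion.2
            ⟨j, Finset.mem_univ j, Finset.mem_filter.2 ⟨hxM, hj⟩⟩)
      have hunion := (Finset.card_le_card hsub).trans ((Finset.card_union_le _ _).trans
        (Nat.add_le_add_left Finset.card_biUnion_le _))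
      refine (Nat.cast_le (α := ℝ).2 hunion).trans ?_
      push_cast
      have hle := Finset.sum_le_sum fun (j : Fin m) (_ : j ∈ Finset.univ) => hcoord d hd (e j)
      simp only [Finset.sum_const, Finset.card_univ, Fintype.card_fin, nsmul_eq_mul] at hle
      linarith [hsum d hd])
  have hinj : Set.InjOn (contractedCycle I₂ e) (D₀ : Set (Fin k → Fin n → ZMod p)) := by
    intro a ha b hb hab
    by_contra hne
    exact hD₀ a ha b hb hne ⟨0, congrFun hab 0⟩
  set u := r / (4 * (k : ℝ)) with hu
  have hu0 : 0 < u := by positivity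
  have hu1 : 8 * u ≤ 1 := by
    rw [hu, ← mul_div_assoc, div_le_one (by positivity)]
    linarith
  have hD₀card : 2 * u / θ * N ≤ D₀.card := by
    have hmk : (m : ℝ) + 4 ≤ 2 * k := by exact_mod_cast (by omega : m + 4 ≤ 2 * k)
    have h₁ : r * δ' * N ^ (k - 1) ≤ D₀.card * (2 * k * W) :=
      (hMcard.trans hMD₀).trans (by gcongr)
    rw [show k - 1 = (k - 2) + 1 by omega, pow_succ] at h₁
    refine le_of_mul_le_mul_right ?_ (show 0 < 2 * k * W by positivity)
    refine le_trans (le_of_eq ?_) h₁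
    rw [hu, hW]
    field_simp
    ring
  have huθ : 2 * u / θ ≤ 1 / 4 := by
    rw [div_le_iff₀ hθ0]
    linarith
  obtain ⟨D, hDD₀, hDcard⟩ := Finset.exists_subset_card_eq (Nat.ceil_le.2 hD₀card)
  have hDlow : 2 * u / θ * N ≤ D.card := hDcard ▸ Nat.le_ceil _
  have hDhigh : (D.card : ℝ) < N := by
    have h₁ : (D.card : ℝ) < 2 * u / θ * N + 1 := hDcard ▸ Nat.ceil_lt_add_one (by positivity)
    nlinarith
  have hDM : D ⊆ M := hDD₀.trans hD₀M
  have hεD : D.card / N * N = D.card := div_mul_cancel₀ _ hN0.ne'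
  have hεlow : 2 * u / θ ≤ D.card / N := (le_div_iff₀ hN0).2 hDlow
  have hcount := H (m + 1) (by omega) (by omega) (D.card / N)
    (lt_of_lt_of_le (by positivity) hεlow) ((div_lt_one hN0).2 hDhigh) n hn
    (contractedSets X I₂ e D)
    ⟨D.image (contractedCycle I₂ e), by
      intro y hy
      obtain ⟨d, hd, rfl⟩ := Finset.mem_image.1 hy
      exact contractedCycle_mem hI₁₂ hIu e (hDM.trans hM) hd, by
      intro y hy z hz hyz j hj
      obtain ⟨a, ha, rfl⟩ := Finset.mem_image.1 hy
      obtain ⟨b, hb, rfl⟩ := Finset.mem_image.1 hz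
      exact hD₀ a (hDD₀ ha) b (hDD₀ hb) (fun h => hyz (h ▸ rfl)) ⟨j, hj⟩, by
      rw [Finset.card_image_of_injOn (hinj.mono (Finset.coe_subset.2 hDD₀)), ← hNdef, hεD]⟩
  refine rpow_le_mul_rpow_of_rpow_le hc0 hc1 hI₁a (by omega) hN0 hθ0 hα0 hαk hu0
    (by linarith) hεlow (hcount.trans ?_)
  rw [hεD]
  exact card_cycleSet_contractedSets_le hI₁₂ hIu e (hDM.trans hM) (by positivity)
    fun d hd => hext d (hDM hd)
end

section
/- Let p be a prime, k ≥ 4 an integer, 2 ≤ ℓ ≤ k−2, α > 0 a real number, n a positive integer, and X_1,…,X_k ⊆ F_p^n. Suppose (x_1,…,x_{ℓ−1}) ∈ X_1×⋯×X_{ℓ−1} is not a bad [ℓ−1]-tuple. Then for each j ∈ {ℓ+2,…,k}, the number of elements x_j ∈ X_j such that (x_1,…,x_{ℓ−1},x_j) is a bad ([ℓ−1]∪{j})-tuple is at most αN. -/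
open scoped Classical

/-- Cycles extending an `I`-tuple are partitioned according to their value at `j`. -/
theorem sum_card_extensions_update_le {V : Type} [AddCommGroup V] [Fintype V] {k : ℕ}
    (X : Fin k → Finset V) {I : Finset (Fin k)} {j : Fin k} (hj : j ∉ I) (x : Fin k → V)
    (S : Finset V) :
    ∑ a ∈ S, ((cycleSet k X).filter fun y => ∀ i ∈ I ∪ {j}, y i = Function.update x j a i).card ≤
      ((cycleSet k X).filter fun y => ∀ i ∈ I, y i = x i).card := by
  rw [← Finset.card_biUnion]
  · refine Finset.card_le_card fun y hy => ?_
    simp only [Finset.mem_biUnion, Finset.mem_filter] at hy ⊢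
    obtain ⟨a, -, hy, h⟩ := hy
    refine ⟨hy, fun i hi => ?_⟩
    rw [h i (Finset.mem_union_left _ hi), Function.update_of_ne (ne_of_mem_of_not_mem hi hj)]
  · intro a _ b _ hab
    refine Finset.disjoint_left.2 fun y hya hyb => hab ?_
    have ha := (Finset.mem_filter.1 hya).2 j (by simp)
    have hb := (Finset.mem_filter.1 hyb).2 j (by simp)
    simpa using ha.symm.trans hb

/-- A tuple that is not bad has at most `α * N` bad extensions by one coordinate. -/
theorem card_bad_extensions_le {V : Type} [AddCommGroup V] [Fintype V] {k : ℕ}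
    (X : Fin k → Finset V) {α N : ℝ} (hα : 0 < α) (hN : 0 < N) {I : Finset (Fin k)}
    (hI : I.card + 2 ≤ k) {j : Fin k} (hj : j ∉ I) {x : Fin k → V} (hx : ¬ IsBad k X α N I x) :
    (((X j).filter fun a => IsBad k X α N (I ∪ {j}) (Function.update x j a)).card : ℝ)
      ≤ α * N := by
  by_contra! h
  refine hx ?_
  set S := (X j).filter fun a => IsBad k X α N (I ∪ {j}) (Function.update x j a)
  have hcard : (I ∪ {j}).card = I.card + 1 := by
    rw [Finset.card_union_of_disjoint (by simpa using hj), Finset.card_singleton]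
  obtain ⟨m, hm⟩ : ∃ m, k = I.card + 2 + m := Nat.exists_eq_add_of_le hI
  have hle := sum_card_extensions_update_le X hj x S
  have hbad : ∀ a ∈ S, 2 * α ^ m * N ^ m ≤
      (((cycleSet k X).filter fun y =>
        ∀ i ∈ I ∪ {j}, y i = Function.update x j a i).card : ℝ) := by
    intro a ha
    have hb := (Finset.mem_filter.1 ha).2
    unfold IsBad at hb
    rwa [hcard, show k - (I.card + 1) - 1 = m by lia] at hb
  unfold IsBad
  rw [show k - I.card - 1 = m + 1 by lia]
  calc 2 * α ^ (m + 1) * N ^ (m + 1) = (α * N) * (2 * α ^ m * N ^ m) := by ring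
    _ ≤ S.card * (2 * α ^ m * N ^ m) := by gcongr
    _ = ∑ _a ∈ S, 2 * α ^ m * N ^ m := by rw [Finset.sum_const, nsmul_eq_mul]
    _ ≤ _ := Finset.sum_le_sum hbad
    _ ≤ _ := by exact_mod_cast hle

theorem few_bad_extensions (p : ℕ) [hp : Fact p.Prime] (k : ℕ) (hk : 4 ≤ k)
    (ℓ : ℕ) (hℓ2 : 2 ≤ ℓ) (hℓk : ℓ + 2 ≤ k)
    (α : ℝ) (hα : 0 < α)
    (n : ℕ) (hn : 0 < n) (X : Fin k → Finset (Fin n → ZMod p))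
    (x : Fin k → (Fin n → ZMod p)) (hx : ∀ i : Fin k, (i : ℕ) + 1 < ℓ → x i ∈ X i)
    (hxgood : ¬ IsBad k X α ((p : ℝ) ^ n)
      (Finset.univ.filter fun i : Fin k => (i : ℕ) + 1 < ℓ) x) :
    ∀ j : Fin k, ℓ + 1 ≤ (j : ℕ) →
      (((X j).filter fun a => IsBad k X α ((p : ℝ) ^ n)
          ((Finset.univ.filter fun i : Fin k => (i : ℕ) + 1 < ℓ) ∪ {j})
          (Function.update x j a)).card : ℝ) ≤ α * (p : ℝ) ^ n := by
  intro j hj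
  have hp0 : (0 : ℝ) < p := by exact_mod_cast hp.out.pos
  refine card_bad_extensions_le X hα (by positivity) ?_ ?_ hxgood
  · have hcard : (Finset.univ.filter fun i : Fin k => (i : ℕ) + 1 < ℓ).card ≤
        (Finset.range ℓ).card :=
      Finset.card_le_card_of_injOn (fun i => (i : ℕ))
        (fun i hi => by
          have := (Finset.mem_filter.1 hi).2
          simp only [Finset.coe_range, Set.mem_Iio]
          lia)
        Fin.val_injective.injOn
    rw [Finset.card_range] at hcard
    lia
  · simp only [Finset.mem_filter, Finset.mem_univ, true_and]
    lia
end
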